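/- Let x ∈ X be neither a loop nor a coloop. Then the sequence 0 → 𝒟(X/x) → 𝒟(X) → 𝒟(X∖x) → 0 is exact, where the first map is the inclusion j_x and the second is the directional derivative D_x: the subspace j_x(𝒟(X/x)) is contained in 𝒟(X), D_x maps 𝒟(X) onto 𝒟(X∖x), and {f ∈ 𝒟(X) : D_x f = 0} = j_x(𝒟(X/x)). -/

import Mathlib

noncomputable section

variable {r N : ℕ}

/-- `p_u`, the degree-one polynomial associated with the vector `u ∈ ℝ^r`. -/
def linPoly {r : ℕ} (u : Fin r → ℝ) : MvPolynomial (Fin r) ℝ :=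
  ∑ i, MvPolynomial.C (u i) * MvPolynomial.X i

/-- `p_Y = ∏_{i ∈ Y} p_{X i}` for a sublist `Y` of the list `X`. -/
def prodPoly {r N : ℕ} (X : Fin N → Fin r → ℝ) (Y : Finset (Fin N)) : MvPolynomial (Fin r) ℝ :=
  ∏ i ∈ Y, linPoly (X i)

/-- The pairing `⟨p, f⟩ = (p(∂/∂t₁,…,∂/∂t_r) f)(0)`, written via coefficients:
`⟨p,f⟩ = ∑_α α! · p_α · f_α`. -/
def pairing {r : ℕ} (p f : MvPolynomial (Fin r) ℝ) : ℝ :=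
  ∑ α ∈ p.support, (∏ i, ((α i).factorial : ℝ)) * p.coeff α * f.coeff α

lemma pairing_zero {r : ℕ} (q : MvPolynomial (Fin r) ℝ) : pairing q 0 = 0 := by
  simp [pairing]

lemma pairing_add {r : ℕ} (q f g : MvPolynomial (Fin r) ℝ) :
    pairing q (f + g) = pairing q f + pairing q g := by
  unfold pairing
  rw [← Finset.sum_add_distrib]
  exact Finset.sum_congr rfl fun α _ => by rw [MvPolynomial.coeff_add]; ring

lemma pairing_smul {r : ℕ} (q : MvPolynomial (Fin r) ℝ) (c : ℝ) (f : MvPolynomial (Fin r) ℝ) :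
    pairing q (c • f) = c * pairing q f := by
  unfold pairing
  rw [Finset.mul_sum]
  exact Finset.sum_congr rfl fun α _ => by rw [MvPolynomial.coeff_smul, smul_eq_mul]; ring

/-- The kernel (Macaulay inverse system) of an ideal `I`:
all polynomials annihilated (in the sense of the pairing) by every element of `I`. -/
def kerIdeal {r : ℕ} (I : Ideal (MvPolynomial (Fin r) ℝ)) :
    Submodule ℝ (MvPolynomial (Fin r) ℝ) where
  carrier := {f | ∀ q ∈ I, pairing q f = 0}
  add_mem' := fun hf hg q hq => by
    rw [pairing_add, hf q hq, hg q hq, add_zero]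
  zero_mem' := fun q _ => pairing_zero q
  smul_mem' := fun c f hf q hq => by
    rw [pairing_smul, hf q hq, mul_zero]

section Lists

variable {M : Type*} [AddCommGroup M] [Module ℝ M]

/-- `B ⊆ G` is (the index set of) a sublist of the list `v` restricted to the ground set `G`
that is a basis of the ambient space. -/
def basesOn (v : Fin N → M) (G : Finset (Fin N)) : Set (Finset (Fin N)) :=
  {B | B ⊆ G ∧ LinearIndependent ℝ ((B : Set (Fin N)).restrict v) ∧
    Submodule.span ℝ (v '' (B : Set (Fin N))) = ⊤}

/-- `j` is externally active with respect to the basis `B`: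
`v j ∈ span {v e : e ∈ B, e ≤ j}` and `j ∉ B`. -/
def isExtActive (v : Fin N → M) (B : Finset (Fin N)) (j : Fin N) : Prop :=
  j ∉ B ∧ v j ∈ Submodule.span ℝ (v '' {e : Fin N | e ∈ B ∧ e ≤ j})

open Classical in
/-- The set `E(B)` of externally active elements (within the ground set `G`). -/
def extSetOn (v : Fin N → M) (G B : Finset (Fin N)) : Finset (Fin N) :=
  G.filter (fun j => isExtActive v B j)

/-- `C` is a cocircuit w.r.t. the collection of bases `𝔅`: an inclusion-minimal
sublist of the ground set `G` intersecting every basis in `𝔅`. -/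
def isCocircuitOn (G : Finset (Fin N)) (𝔅 : Set (Finset (Fin N))) (C : Finset (Fin N)) : Prop :=
  C ⊆ G ∧ (∀ B ∈ 𝔅, (C ∩ B).Nonempty) ∧
    ∀ C' ⊆ C, (∀ B ∈ 𝔅, (C' ∩ B).Nonempty) → C' = C

/-- A set of bases `𝔅` of the list `v` has the forward exchange property. -/
def forwardExchange (v : Fin N → M) (𝔅 : Set (Finset (Fin N))) : Prop :=
  ∀ B ∈ 𝔅, ∀ b ∈ B, ∀ j : Fin N,
    v j ∈ Submodule.span ℝ (v '' {e : Fin N | e ∈ B ∧ e ≤ b}) →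
    v j ∉ Submodule.span ℝ (v '' {e : Fin N | e ∈ B ∧ e < b}) →
    ¬ isExtActive v B j →
    insert j (B.erase b) ∈ 𝔅

end Lists

/-- The ideal `𝒥` generated by the cocircuit polynomials `p_C`. -/
def Jideal (X : Fin N → Fin r → ℝ) (G : Finset (Fin N)) (𝔅 : Set (Finset (Fin N))) :
    Ideal (MvPolynomial (Fin r) ℝ) :=
  Ideal.span {p | ∃ C : Finset (Fin N), isCocircuitOn G 𝔅 C ∧ p = prodPoly X C}

/-- The generalised `𝒟`-space: the kernel of the cocircuit ideal. -/
def Dspace (X : Fin N → Fin r → ℝ) (G : Finset (Fin N)) (𝔅 : Set (Finset (Fin N))) :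
    Submodule ℝ (MvPolynomial (Fin r) ℝ) :=
  kerIdeal (Jideal X G 𝔅)

/-- `Q_B := p_{X∖(B ∪ E(B))}` (within the ground set `G`). -/
def QB (X : Fin N → Fin r → ℝ) (G B : Finset (Fin N)) : MvPolynomial (Fin r) ℝ :=
  prodPoly X (G \ (B ∪ extSetOn X G B))

/-- The central `𝒫`-space: the span of `p_Y` over sublists `Y` of `G` whose complement spans. -/
def PspaceOn (X : Fin N → Fin r → ℝ) (G : Finset (Fin N)) :
    Submodule ℝ (MvPolynomial (Fin r) ℝ) :=
  Submodule.span ℝ {p | ∃ Y : Finset (Fin N), Y ⊆ G ∧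
    Submodule.span ℝ (X '' ((G \ Y : Finset (Fin N)) : Set (Fin N))) = ⊤ ∧ p = prodPoly X Y}

/-- The generalised `𝒫`-space `𝒫(X,𝔅') = span {Q_B : B ∈ 𝔅'}`. -/
def PspaceB (X : Fin N → Fin r → ℝ) (G : Finset (Fin N)) (𝔅 : Set (Finset (Fin N))) :
    Submodule ℝ (MvPolynomial (Fin r) ℝ) :=
  Submodule.span ℝ {p | ∃ B ∈ 𝔅, p = QB X G B}

/-- The directional derivative `D_u = ∑ i, uᵢ ∂/∂tᵢ` as a linear map. -/
def dirDeriv {r : ℕ} (u : Fin r → ℝ) :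
    MvPolynomial (Fin r) ℝ →ₗ[ℝ] MvPolynomial (Fin r) ℝ :=
  ∑ i, u i • (MvPolynomial.pderiv i).toLinearMap

end

/-- `𝒟(X/x)`, realised inside `ℝ[t₁,…,t_r]` via the identification of
`Sym((ℝ^r/ℝx)^*)` with the subalgebra `{f : D_x f = 0}`: the polynomials `f` with
`D_x f = 0` annihilated by the ideal generated by the cocircuit polynomials of the
contracted list `X/x` (cocircuit polynomials taken as the lifts `p_C`, which act
correctly on polynomials with `D_x f = 0`). -/
noncomputable def DspaceContr {r N : ℕ} (X : Fin N → Fin r → ℝ) (i0 : Fin N) :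
    Submodule ℝ (MvPolynomial (Fin r) ℝ) :=
  Dspace X (Finset.univ.erase i0)
      (basesOn ((Submodule.span ℝ {X i0}).mkQ ∘ X) (Finset.univ.erase i0)) ⊓
    LinearMap.ker (dirDeriv (X i0))

section QuotientSequence

variable {K V : Type*} [Field K] [AddCommGroup V] [Module K V]

/-- Dimension bounds for the map `V ⧸ A → V ⧸ I` induced by `f`, whose cokernel is a quotient of
`V ⧸ A'`; if they are attained, the map is injective. -/
lemma finrank_quotient_le_of_comap {A I A' : Submodule K V} {f : V →ₗ[K] V}
    (hA : A ≤ I.comap f) (hA' : A' ≤ I ⊔ LinearMap.range f)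
    [Module.Finite K (V ⧸ A)] [Module.Finite K (V ⧸ A')] :
    Module.Finite K (V ⧸ I) ∧
      Module.finrank K (V ⧸ I) ≤ Module.finrank K (V ⧸ A) + Module.finrank K (V ⧸ A') ∧
      (Module.finrank K (V ⧸ A) + Module.finrank K (V ⧸ A') ≤ Module.finrank K (V ⧸ I) →
        I.comap f ≤ A) := by
  set φ : (V ⧸ A) →ₗ[K] (V ⧸ I) := A.mapQ I f hA with hφ
  have hker : A' ≤ LinearMap.ker ((LinearMap.range φ).mkQ ∘ₗ I.mkQ) := by
    refine hA'.trans (sup_le ?_ ?_)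
    · intro v hv
      have : I.mkQ v = 0 := by simpa using hv
      simp only [LinearMap.mem_ker, LinearMap.comp_apply, this, map_zero]
    · rintro _ ⟨v, rfl⟩
      simp only [LinearMap.mem_ker, LinearMap.comp_apply, Submodule.mkQ_apply,
        Submodule.Quotient.mk_eq_zero]
      exact ⟨Submodule.Quotient.mk v, by simp [hφ]⟩
  set ψ : (V ⧸ A') →ₗ[K] ((V ⧸ I) ⧸ LinearMap.range φ) := A'.liftQ _ hker
  have hψ : Function.Surjective ψ := by
    intro y
    obtain ⟨y, rfl⟩ := Submodule.mkQ_surjective _ y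
    obtain ⟨v, rfl⟩ := Submodule.mkQ_surjective _ y
    exact ⟨Submodule.Quotient.mk v, rfl⟩
  have : Module.Finite K ((V ⧸ I) ⧸ LinearMap.range φ) := Module.Finite.of_surjective ψ hψ
  have hfin : Module.Finite K (V ⧸ I) := Module.Finite.of_submodule_quotient (LinearMap.range φ)
  have h1 := LinearMap.finrank_le_finrank_of_surjective hψ
  have h2 := Submodule.finrank_quotient_add_finrank (LinearMap.range φ)
  have h3 := LinearMap.finrank_range_add_finrank_ker φ
  refine ⟨hfin, by omega, fun h v hv => ?_⟩
  have h4 : LinearMap.ker φ = ⊥ := Submodule.finrank_eq_zero.1 (by omega)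
  have h5 : φ (Submodule.Quotient.mk v) = 0 := by
    simpa [hφ] using hv
  simpa using LinearMap.ker_eq_bot'.1 h4 _ h5

end QuotientSequence

section Deformation

open MvPolynomial

variable {σ : Type*}

/-- The polynomials of total degree less than `n`. -/
noncomputable def degreeLT (σ : Type*) (n : ℕ) : Submodule ℝ (MvPolynomial σ ℝ) :=
  restrictSupport ℝ {α | α.degree < n}

lemma mem_degreeLT {n : ℕ} {p : MvPolynomial σ ℝ} :
    p ∈ degreeLT σ n ↔ ∀ α, n ≤ α.degree → p.coeff α = 0 := by
  rw [degreeLT, mem_restrictSupport_iff]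
  constructor
  · intro h α hα
    by_contra h0
    exact absurd (h (mem_support_iff.2 h0)) (not_lt.2 hα)
  · intro h α hα
    by_contra h0
    exact mem_support_iff.1 hα (h α (not_lt.1 h0))

lemma mul_mem_degreeLT {m k : ℕ} {p q : MvPolynomial σ ℝ} (hp : p ∈ degreeLT σ (m + 1))
    (hq : q ∈ degreeLT σ k) : p * q ∈ degreeLT σ (m + k) := by
  classical
  rw [mem_degreeLT] at *
  intro α hα
  rw [coeff_mul]
  refine Finset.sum_eq_zero fun x hx => ?_
  rw [Finset.HasAntidiagonal.mem_antidiagonal] at hx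
  have : x.1.degree + x.2.degree = α.degree := by rw [← hx, map_add]
  by_cases h : m + 1 ≤ x.1.degree
  · rw [hp _ h, zero_mul]
  · rw [hq _ (by omega), mul_zero]

lemma MvPolynomial.IsHomogeneous.mem_degreeLT {n : ℕ} {p : MvPolynomial σ ℝ}
    (hp : p.IsHomogeneous n) : p ∈ degreeLT σ (n + 1) := by
  rw [_root_.mem_degreeLT]
  intro α hα
  exact hp.coeff_eq_zero (by omega)

lemma degreeLT_mono {m n : ℕ} (h : m ≤ n) : degreeLT σ m ≤ degreeLT σ n := fun p hp => by
  rw [mem_degreeLT] at *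
  exact fun α hα => hp α (h.trans hα)

/-- If monomials span the quotient by an ideal with homogeneous generators, then they span the
quotient by any ideal obtained by perturbing the generators by terms of lower degree. -/
lemma span_monomials_sup_eq_top {ι : Type*} {d : ι → ℕ} {p p' : ι → MvPolynomial σ ℝ}
    (hp : ∀ i, (p i).IsHomogeneous (d i)) (hp' : ∀ i, p i - p' i ∈ degreeLT σ (d i))
    {W : Submodule ℝ (MvPolynomial σ ℝ)} {T : Set (MvPolynomial σ ℝ)}
    (hT : T ⊆ Set.range fun α => monomial α 1) (hW : W = Submodule.span ℝ T)
    (htop : W ⊔ (Ideal.span (Set.range p)).restrictScalars ℝ = ⊤) :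
    W ⊔ (Ideal.span (Set.range p')).restrictScalars ℝ = ⊤ := by
  set J := Ideal.span (Set.range p)
  set J' := Ideal.span (Set.range p')
  have hcW : ∀ n, ∀ w ∈ W, homogeneousComponent n w ∈ W := by
    intro n w hw
    suffices W ≤ W.comap (homogeneousComponent n) from this hw
    conv_lhs => rw [hW]
    rw [Submodule.span_le]
    intro t ht
    obtain ⟨α, rfl⟩ := hT ht
    have h1 : monomial α (1 : ℝ) ∈ W := hW ▸ Submodule.subset_span ht
    simp only [Submodule.comap_coe, Set.mem_preimage, SetLike.mem_coe]
    rw [homogeneousComponent_of_mem (isHomogeneous_monomial (1 : ℝ) rfl)]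
    split_ifs
    · exact h1
    · exact zero_mem _
  have hcJ : ∀ n, ∀ j ∈ J,
      homogeneousComponent n j ∈ J'.restrictScalars ℝ ⊔ degreeLT σ n := by
    intro n j hj
    refine Submodule.span_induction (p := fun j _ => ∀ a : MvPolynomial σ ℝ,
      homogeneousComponent n (a * j) ∈ J'.restrictScalars ℝ ⊔ degreeLT σ n)
      ?_ ?_ ?_ ?_ hj 1 |> (by simpa using ·)
    · rintro _ ⟨i, rfl⟩ a
      induction a using MvPolynomial.induction_on' with
      | add a b ha hb => rw [add_mul, map_add]; exact add_mem ha hb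
      | monomial α c =>
        have hm := isHomogeneous_monomial c (rfl : α.degree = α.degree)
        rw [homogeneousComponent_of_mem (hm.mul (hp i))]
        split_ifs with h
        · have : monomial α c * p i = monomial α c * p' i + monomial α c * (p i - p' i) := by ring
          rw [this]
          refine Submodule.add_mem_sup ?_ ?_
          · exact J'.mul_mem_left _ (Ideal.subset_span ⟨i, rfl⟩)
          · rw [h]
            exact mul_mem_degreeLT hm.mem_degreeLT (hp' i)
        · exact zero_mem _
    · intro a; simp
    · intro x y _ _ hx hy a
      rw [mul_add, map_add]; exact add_mem (hx a) (hy a)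
    · intro b x _ hx a
      rw [smul_eq_mul, ← mul_assoc]; exact hx _
  have key : ∀ n, degreeLT σ n ≤ W ⊔ J'.restrictScalars ℝ := by
    intro n
    induction n with
    | zero =>
      intro q hq
      rw [mem_degreeLT] at hq
      have : q = 0 := by ext α; simpa using hq α (Nat.zero_le _)
      rw [this]; exact zero_mem _
    | succ n ih =>
      intro q hq
      have hq1 : q - homogeneousComponent n q ∈ degreeLT σ n := by
        rw [mem_degreeLT] at *
        intro α hα
        rw [coeff_sub, coeff_homogeneousComponent]
        split_ifs with h
        · simp
        · rw [hq α (by omega), sub_zero]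
      have hq2 : homogeneousComponent n q ∈ W ⊔ J'.restrictScalars ℝ := by
        obtain ⟨w, hw, j, hj, rfl⟩ := Submodule.mem_sup.1 (htop ▸ Submodule.mem_top : q ∈ _)
        rw [map_add]
        refine add_mem (Submodule.mem_sup_left (hcW n w hw)) ?_
        exact (sup_le le_sup_right ih) (hcJ n j hj)
      have := add_mem (ih hq1) hq2
      simpa using this
  rw [eq_top_iff]
  intro q _
  refine key (q.totalDegree + 1) (mem_degreeLT.2 fun α hα => ?_)
  exact coeff_eq_zero_of_totalDegree_lt (by rw [← Finsupp.degree_apply]; omega)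

end Deformation

section NonspanningIdeal

open MvPolynomial

variable {r N : ℕ}

lemma linPoly_add (u v : Fin r → ℝ) : linPoly (u + v) = linPoly u + linPoly v := by
  simp [linPoly, add_mul, Finset.sum_add_distrib]

lemma linPoly_smul (c : ℝ) (u : Fin r → ℝ) : linPoly (c • u) = C c * linPoly u := by
  simp [linPoly, Finset.mul_sum, mul_assoc]

lemma linPoly_single (i : Fin r) : linPoly (Pi.single i 1) = X i := by
  rw [linPoly, Finset.sum_eq_single i] <;> simp +contextual

/-- The ideal generated by `p_C`, for `C ⊆ G` whose complement in `G` does not span modulo `L`. -/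
noncomputable def nonspanIdeal (X : Fin N → Fin r → ℝ) (G : Finset (Fin N))
    (L : Submodule ℝ (Fin r → ℝ)) : Ideal (MvPolynomial (Fin r) ℝ) :=
  Ideal.span {p | ∃ C ⊆ G,
    Submodule.span ℝ (X '' ((G \ C : Finset (Fin N)) : Set (Fin N))) ⊔ L ≠ ⊤ ∧ p = prodPoly X C}

/-- The ideal generated by the linear forms `p_u`, `u ∈ L`. -/
noncomputable def linIdeal (L : Submodule ℝ (Fin r → ℝ)) : Ideal (MvPolynomial (Fin r) ℝ) :=
  Ideal.span (linPoly '' L)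

lemma linIdeal_bot : linIdeal (⊥ : Submodule ℝ (Fin r → ℝ)) = ⊥ := by
  simp [linIdeal, linPoly]

lemma linIdeal_sup_span_singleton (L : Submodule ℝ (Fin r → ℝ)) (u : Fin r → ℝ) :
    linIdeal (L ⊔ Submodule.span ℝ {u}) = linIdeal L ⊔ Ideal.span {linPoly u} := by
  apply le_antisymm
  · refine Ideal.span_le.2 ?_
    rintro _ ⟨v, hv, rfl⟩
    obtain ⟨l, hl, w, hw, rfl⟩ := Submodule.mem_sup.1 hv
    obtain ⟨c, rfl⟩ := Submodule.mem_span_singleton.1 hw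
    rw [linPoly_add, linPoly_smul]
    exact Submodule.add_mem_sup (Ideal.subset_span ⟨l, hl, rfl⟩)
      (Ideal.mul_mem_left _ _ (Ideal.mem_span_singleton_self _))
  · refine sup_le (Ideal.span_mono (Set.image_mono fun v hv => Submodule.mem_sup_left hv)) ?_
    rw [Ideal.span_singleton_le_iff_mem]
    exact Ideal.subset_span
      ⟨u, Submodule.mem_sup_right (Submodule.mem_span_singleton_self u), rfl⟩

lemma idealOfVars_le_linIdeal_top : idealOfVars (Fin r) ℝ ≤ linIdeal ⊤ := by
  refine Ideal.span_le.2 ?_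
  rintro _ ⟨i, rfl⟩
  exact Ideal.subset_span ⟨_, trivial, linPoly_single i⟩

variable {X : Fin N → Fin r → ℝ} {G : Finset (Fin N)} {L : Submodule ℝ (Fin r → ℝ)} {x : Fin N}

lemma prodPoly_mem_nonspanIdeal {C : Finset (Fin N)} (hC : C ⊆ G)
    (h : Submodule.span ℝ (X '' ((G \ C : Finset (Fin N)) : Set (Fin N))) ⊔ L ≠ ⊤) :
    prodPoly X C ∈ nonspanIdeal X G L :=
  Ideal.subset_span ⟨C, hC, h, rfl⟩

lemma span_image_insert_sup (B : Finset (Fin N)) :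
    Submodule.span ℝ (X '' ((insert x B : Finset (Fin N)) : Set (Fin N))) ⊔ L =
      Submodule.span ℝ (X '' (B : Set (Fin N))) ⊔ (L ⊔ Submodule.span ℝ {X x}) := by
  rw [Finset.coe_insert, Set.image_insert_eq, Submodule.span_insert, sup_assoc, sup_comm,
    sup_assoc]

lemma linPoly_mul_mem_nonspanIdeal (hx : x ∉ G) {h : MvPolynomial (Fin r) ℝ}
    (hh : h ∈ nonspanIdeal X G L) : linPoly (X x) * h ∈ nonspanIdeal X (insert x G) L := by
  suffices nonspanIdeal X G L ≤
      Submodule.comap (LinearMap.mulLeft (MvPolynomial (Fin r) ℝ) (linPoly (X x)))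
        (nonspanIdeal X (insert x G) L) from this hh
  refine Ideal.span_le.2 ?_
  rintro _ ⟨C, hC, hs, rfl⟩
  have hxC : x ∉ C := fun h => hx (hC h)
  have : linPoly (X x) * prodPoly X C = prodPoly X (insert x C) := by
    rw [prodPoly, prodPoly, Finset.prod_insert hxC]
  simp only [Submodule.comap_coe, Set.mem_preimage, LinearMap.mulLeft_apply, SetLike.mem_coe, this]
  refine prodPoly_mem_nonspanIdeal (Finset.insert_subset_insert x hC) ?_
  rwa [Finset.insert_sdiff_insert, Finset.sdiff_insert_of_notMem hx]

lemma nonspanIdeal_sup_span_singleton_le (hx : x ∉ G) :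
    nonspanIdeal X G (L ⊔ Submodule.span ℝ {X x}) ≤ nonspanIdeal X (insert x G) L := by
  refine Ideal.span_le.2 ?_
  rintro _ ⟨C, hC, hs, rfl⟩
  refine prodPoly_mem_nonspanIdeal (hC.trans (Finset.subset_insert x G)) ?_
  rwa [Finset.insert_sdiff_of_notMem _ fun h => hx (hC h), span_image_insert_sup]

lemma nonspanIdeal_insert_le :
    nonspanIdeal X (insert x G) L ≤
      nonspanIdeal X G (L ⊔ Submodule.span ℝ {X x}) ⊔ Ideal.span {linPoly (X x)} := by
  refine Ideal.span_le.2 ?_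
  rintro _ ⟨C, hC, hs, rfl⟩
  by_cases hxC : x ∈ C
  · refine Submodule.mem_sup_right (Ideal.mem_span_singleton.2 ?_)
    exact Finset.dvd_prod_of_mem _ hxC
  · refine Submodule.mem_sup_left
      (prodPoly_mem_nonspanIdeal ((Finset.subset_insert_iff_of_notMem hxC).1 hC) ?_)
    rwa [Finset.insert_sdiff_of_notMem _ hxC, span_image_insert_sup] at hs

open Classical in
/-- The sublists of `G` mapping to bases of the quotient of `ℝ^r` by `L`. -/
noncomputable def basesMod (X : Fin N → Fin r → ℝ) (G : Finset (Fin N))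
    (L : Submodule ℝ (Fin r → ℝ)) : Finset (Finset (Fin N)) :=
  {B ∈ G.powerset | Submodule.span ℝ (X '' (B : Set (Fin N))) ⊔ L = ⊤ ∧
    B.card + Module.finrank ℝ L = r}

lemma mem_basesMod {B : Finset (Fin N)} : B ∈ basesMod X G L ↔ B ⊆ G ∧
    Submodule.span ℝ (X '' (B : Set (Fin N))) ⊔ L = ⊤ ∧ B.card + Module.finrank ℝ L = r := by
  simp [basesMod]

lemma basesMod_mono {G' : Finset (Fin N)} (h : G ⊆ G') : basesMod X G L ⊆ basesMod X G' L :=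
  fun B hB => by
    rw [mem_basesMod] at *
    exact ⟨hB.1.trans h, hB.2⟩

lemma card_basesMod_add_le (hx : x ∉ G) (hL : X x ∉ L) :
    (basesMod X G L).card + (basesMod X G (L ⊔ Submodule.span ℝ {X x})).card ≤
      (basesMod X (insert x G) L).card := by
  classical
  have hinj : Set.InjOn (insert x)
      (basesMod X G (L ⊔ Submodule.span ℝ {X x}) : Set (Finset (Fin N))) := by
    intro B hB B' hB' h
    have h1 : x ∉ B := fun h => hx ((mem_basesMod.1 hB).1 h)
    have h2 : x ∉ B' := fun h => hx ((mem_basesMod.1 hB').1 h)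
    rw [← Finset.erase_insert h1, h, Finset.erase_insert h2]
  rw [← Finset.card_image_of_injOn hinj, ← Finset.card_union_of_disjoint]
  · refine Finset.card_le_card (Finset.union_subset (basesMod_mono (Finset.subset_insert x G)) ?_)
    intro A hA
    obtain ⟨B, hB, rfl⟩ := Finset.mem_image.1 hA
    obtain ⟨h1, h2, h3⟩ := mem_basesMod.1 hB
    refine mem_basesMod.2 ⟨Finset.insert_subset_insert x h1, ?_, ?_⟩
    · rwa [span_image_insert_sup]
    · rw [Submodule.finrank_sup_span_singleton hL] at h3
      rw [Finset.card_insert_of_notMem fun h => hx (h1 h)]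
      omega
  · rw [Finset.disjoint_left]
    intro A hA hA'
    obtain ⟨B, -, rfl⟩ := Finset.mem_image.1 hA'
    exact hx ((mem_basesMod.1 hA).1 (Finset.mem_insert_self x B))

/-- The real vector space underlying the ideal of the list `G` modulo `L`. -/
noncomputable def relationSpace (X : Fin N → Fin r → ℝ) (G : Finset (Fin N))
    (L : Submodule ℝ (Fin r → ℝ)) : Submodule ℝ (MvPolynomial (Fin r) ℝ) :=
  (nonspanIdeal X G L ⊔ linIdeal L).restrictScalars ℝ

lemma relationSpace_le_comap (hx : x ∉ G) :
    relationSpace X G L ≤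
      (relationSpace X (insert x G) L).comap (LinearMap.mulLeft ℝ (linPoly (X x))) := by
  intro h hh
  obtain ⟨a, ha, b, hb, rfl⟩ := Submodule.mem_sup.1 hh
  simp only [Submodule.mem_comap, LinearMap.mulLeft_apply, mul_add]
  exact Submodule.add_mem_sup (linPoly_mul_mem_nonspanIdeal hx ha) (Ideal.mul_mem_left _ _ hb)

lemma sup_linIdeal_le_sup_span_singleton (hx : x ∉ G) :
    nonspanIdeal X G (L ⊔ Submodule.span ℝ {X x}) ⊔ linIdeal (L ⊔ Submodule.span ℝ {X x}) ≤
      (nonspanIdeal X (insert x G) L ⊔ linIdeal L) ⊔ Ideal.span {linPoly (X x)} := by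
  rw [linIdeal_sup_span_singleton, ← sup_assoc]
  exact sup_le_sup_right (sup_le_sup_right (nonspanIdeal_sup_span_singleton_le hx) _) _

lemma relationSpace_sup_span_singleton_le (hx : x ∉ G) :
    relationSpace X G (L ⊔ Submodule.span ℝ {X x}) ≤
      relationSpace X (insert x G) L ⊔ LinearMap.range (LinearMap.mulLeft ℝ (linPoly (X x))) := by
  intro h hh
  obtain ⟨a, ha, b, hb, rfl⟩ := Submodule.mem_sup.1 (sup_linIdeal_le_sup_span_singleton hx hh)
  obtain ⟨c, rfl⟩ := Ideal.mem_span_singleton.1 hb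
  exact Submodule.add_mem_sup ha ⟨c, rfl⟩

lemma nonspanIdeal_le_insert_of_mem (hx : x ∉ G) (hL : X x ∈ L) :
    nonspanIdeal X G L ≤ nonspanIdeal X (insert x G) L := by
  have h := nonspanIdeal_sup_span_singleton_le (X := X) (L := L) hx
  rwa [sup_eq_left.2 ((Submodule.span_singleton_le_iff_mem _ _).2 hL)] at h

lemma finrank_quotient_relationSpace_le (X : Fin N → Fin r → ℝ) (G : Finset (Fin N))
    (L : Submodule ℝ (Fin r → ℝ)) :
    Module.Finite ℝ (MvPolynomial (Fin r) ℝ ⧸ relationSpace X G L) ∧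
      Module.finrank ℝ (MvPolynomial (Fin r) ℝ ⧸ relationSpace X G L) ≤
        (basesMod X G L).card ∧
      ∃ n, idealOfVars (Fin r) ℝ ^ n ≤ nonspanIdeal X G L ⊔ linIdeal L := by
  induction G using Finset.induction_on generalizing L with
  | empty =>
    by_cases hL : L = ⊤
    · subst hL
      have hm : idealOfVars (Fin r) ℝ ≤ nonspanIdeal X ∅ ⊤ ⊔ linIdeal ⊤ :=
        idealOfVars_le_linIdeal_top.trans le_sup_right
      have hsurj : Function.Surjective
          ((relationSpace X ∅ ⊤).mkQ ∘ₗ (Algebra.linearMap ℝ (MvPolynomial (Fin r) ℝ))) := by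
        intro q
        obtain ⟨q, rfl⟩ := Submodule.mkQ_surjective _ q
        refine ⟨q.coeff 0, ?_⟩
        simp only [LinearMap.comp_apply, Submodule.mkQ_apply]
        refine (Submodule.Quotient.eq _).2 (hm ?_)
        rw [← pow_one (idealOfVars (Fin r) ℝ), mem_pow_idealOfVars_iff']
        intro α hα
        have : α = 0 := by rw [← Finsupp.degree_eq_zero_iff]; omega
        subst this
        simp [algebraMap_eq]
      refine ⟨Module.Finite.of_surjective _ hsurj, ?_, 1, by simpa using hm⟩
      have h1 := LinearMap.finrank_le_finrank_of_surjective hsurj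
      rw [Module.finrank_self] at h1
      refine h1.trans (Finset.card_pos.2 ⟨∅, mem_basesMod.2 ⟨subset_rfl, by simp, by simp⟩⟩)
    · have h1 : nonspanIdeal X ∅ L ⊔ linIdeal L = ⊤ := by
        rw [Ideal.eq_top_iff_one]
        exact Submodule.mem_sup_left
          (Ideal.subset_span ⟨∅, subset_rfl, by simpa using hL, by simp [prodPoly]⟩)
      have h2 : relationSpace X ∅ L = ⊤ := by rw [relationSpace, h1]; rfl
      rw [h2, h1]
      refine ⟨inferInstance, ?_, 0, le_top⟩
      rw [Module.finrank_zero_of_subsingleton]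
      exact Nat.zero_le _
  | insert x G hx ih =>
    obtain ⟨hf, hr, n, hn⟩ := ih L
    by_cases hL : X x ∈ L
    · have hle : nonspanIdeal X G L ⊔ linIdeal L ≤ nonspanIdeal X (insert x G) L ⊔ linIdeal L :=
        sup_le_sup_right (nonspanIdeal_le_insert_of_mem hx hL) _
      have hle' : relationSpace X G L ≤ relationSpace X (insert x G) L := hle
      have hs := Submodule.factor_surjective hle'
      exact ⟨Module.Finite.of_surjective _ hs,
        ((LinearMap.finrank_le_finrank_of_surjective hs).trans hr).trans
          (Finset.card_le_card (basesMod_mono (Finset.subset_insert x G))), n, hn.trans hle⟩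
    · obtain ⟨hf', hr', m, hm⟩ := ih (L ⊔ Submodule.span ℝ {X x})
      obtain ⟨h1, h2, -⟩ := finrank_quotient_le_of_comap
        (relationSpace_le_comap (X := X) (L := L) hx)
        (relationSpace_sup_span_singleton_le (X := X) (L := L) hx)
      refine ⟨h1, by have := card_basesMod_add_le (X := X) hx hL; omega, m + n, ?_⟩
      rw [pow_add]
      refine (Ideal.mul_mono (hm.trans (sup_linIdeal_le_sup_span_singleton hx)) hn).trans ?_
      rw [Ideal.sup_mul]
      refine sup_le Ideal.mul_le_left ?_
      rw [Ideal.span_singleton_mul_le_iff]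
      exact fun h hh => relationSpace_le_comap hx hh

end NonspanningIdeal

section GenericVertices

open MvPolynomial

variable {r N : ℕ}

lemma eval_linPoly (u θ : Fin r → ℝ) : eval θ (linPoly u) = u ⬝ᵥ θ := by
  simp [linPoly, dotProduct]

/-- The solution of `⟨X i, θ⟩ = c i`, `i ∈ B`, for a basis `B`. -/
lemma exists_vertex (X : Fin N → Fin r → ℝ) {B : Finset (Fin N)}
    (hB : B ∈ basesMod X Finset.univ ⊥) :
    ∃ T : (Fin N → ℝ) →ₗ[ℝ] (Fin r → ℝ), (∀ c, ∀ i ∈ B, X i ⬝ᵥ T c = c i) ∧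
      ∀ c, (∀ i ∈ B, c i = 0) → T c = 0 := by
  obtain ⟨-, hs, hc⟩ := mem_basesMod.1 hB
  rw [sup_bot_eq] at hs
  rw [finrank_bot, add_zero] at hc
  set E : (Fin r → ℝ) →ₗ[ℝ] (B → ℝ) := Matrix.mulVecLin (Matrix.of fun i : B => X i) with hE
  have hEa : ∀ θ (i : B), E θ i = X i ⬝ᵥ θ := fun θ i => rfl
  have hinj : Function.Injective E := by
    rw [← LinearMap.ker_eq_bot, LinearMap.ker_eq_bot']
    intro θ hθ
    have h1 : ∀ u : Fin r → ℝ, u ⬝ᵥ θ = 0 := by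
      intro u
      have hu : u ∈ Submodule.span ℝ (X '' (B : Set (Fin N))) := hs ▸ Submodule.mem_top
      induction hu using Submodule.span_induction with
      | mem u hu =>
        obtain ⟨i, hi, rfl⟩ := hu
        rw [← hEa θ ⟨i, hi⟩, hθ]; rfl
      | zero => simp
      | add u v _ _ hu hv => rw [add_dotProduct, hu, hv, add_zero]
      | smul a u _ hu => rw [smul_dotProduct, hu, smul_zero]
    exact dotProduct_self_eq_zero.1 (h1 θ)
  have hfr : Module.finrank ℝ (Fin r → ℝ) = Module.finrank ℝ (B → ℝ) := by simp [hc]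
  set e := LinearEquiv.ofInjectiveOfFinrankEq E hinj hfr
  have hee : ∀ θ, e θ = E θ := fun θ => rfl
  refine ⟨e.symm.toLinearMap ∘ₗ LinearMap.funLeft ℝ ℝ (fun i : B => (i : Fin N)), ?_, ?_⟩
  · intro c i hi
    rw [← hEa _ ⟨i, hi⟩, ← hee]
    simp [LinearMap.funLeft]
  · intro c h
    have : LinearMap.funLeft ℝ ℝ (fun i : B => (i : Fin N)) c = 0 := by
      ext i; exact h i i.2
    rw [LinearMap.comp_apply, this, map_zero]

/-- For generic right-hand sides, distinct bases have distinct vertices. -/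
lemma exists_generic_vertices (X : Fin N → Fin r → ℝ) :
    ∃ (c : Fin N → ℝ) (θ : basesMod X Finset.univ ⊥ → Fin r → ℝ),
      (∀ B, ∀ i ∈ B.1, X i ⬝ᵥ θ B = c i) ∧ Function.Injective θ := by
  choose T hT hT0 using fun B : basesMod X Finset.univ ⊥ => exists_vertex X B.2
  have hne : ∀ q : {q : basesMod X Finset.univ ⊥ × basesMod X Finset.univ ⊥ // q.1 ≠ q.2},
      ∃ i ∈ q.1.2.1, i ∉ q.1.1.1 := by
    rintro ⟨⟨B, B'⟩, h⟩
    by_contra! hsub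
    refine h (Subtype.ext (Finset.eq_of_subset_of_card_le hsub ?_).symm)
    have h1 := (mem_basesMod.1 B.2).2.2
    have h2 := (mem_basesMod.1 B'.2).2.2
    dsimp only at *
    omega
  choose i hi hi' using hne
  obtain ⟨c, hc⟩ := Module.Dual.exists_forall_ne_zero_of_forall_exists (K := ℝ)
    (fun q => LinearMap.proj (i q) - (dotProductBilin ℝ ℝ (X (i q))) ∘ₗ T q.1.1)
    (fun q => ⟨Pi.single (i q) 1, by
      have : T q.1.1 (Pi.single (i q) 1) = 0 :=
        hT0 _ _ fun j hj => Pi.single_eq_of_ne (fun h => hi' q (by rwa [← h])) _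
      simp [this]⟩)
  refine ⟨c, fun B => T B c, fun B => hT B c, fun B B' h => ?_⟩
  by_contra hBB
  refine hc ⟨(B, B'), hBB⟩ ?_
  have h1 := hT B' c _ (hi ⟨(B, B'), hBB⟩)
  dsimp only at h
  simp only [LinearMap.sub_apply, LinearMap.proj_apply, LinearMap.comp_apply, h]
  rw [← h1]
  exact sub_self _

lemma linPoly_isHomogeneous (u : Fin r → ℝ) : (linPoly u).IsHomogeneous 1 :=
  IsHomogeneous.sum _ _ _ fun i _ => by
    simpa using (isHomogeneous_C (Fin r) (u i)).mul (isHomogeneous_X ℝ i)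

lemma prodPoly_isHomogeneous (X : Fin N → Fin r → ℝ) (Y : Finset (Fin N)) :
    (prodPoly X Y).IsHomogeneous Y.card := by
  simpa [prodPoly] using IsHomogeneous.prod Y (fun i => linPoly (X i)) (fun _ => 1)
    fun i _ => linPoly_isHomogeneous (X i)

lemma prodPoly_sub_prod_mem_degreeLT (X : Fin N → Fin r → ℝ) (c : Fin N → ℝ)
    (Y : Finset (Fin N)) :
    prodPoly X Y - ∏ i ∈ Y, (linPoly (X i) - C (c i)) ∈ degreeLT (Fin r) Y.card := by
  induction Y using Finset.induction_on with
  | empty => simp [prodPoly]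
  | insert a Y ha ih =>
    have hP := (prodPoly_isHomogeneous X Y).mem_degreeLT
    rw [prodPoly] at *
    rw [Finset.prod_insert ha, Finset.prod_insert ha, Finset.card_insert_of_notMem ha]
    set P := ∏ i ∈ Y, linPoly (X i)
    set P' := ∏ i ∈ Y, (linPoly (X i) - C (c i))
    have : linPoly (X a) * P - (linPoly (X a) - C (c a)) * P' =
        linPoly (X a) * (P - P') + (c a • P - c a • (P - P')) := by
      rw [smul_eq_C_mul, smul_eq_C_mul]; ring
    rw [this]
    refine add_mem ?_ (sub_mem (Submodule.smul_mem _ _ hP) (Submodule.smul_mem _ _ ?_))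
    · rw [add_comm]
      exact mul_mem_degreeLT (linPoly_isHomogeneous _).mem_degreeLT ih
    · exact degreeLT_mono (Nat.le_succ _) ih

/-- A finite-codimensional subspace of the polynomials has a complement spanned by monomials. -/
lemma exists_span_monomials_isCompl {σ : Type*} (A : Submodule ℝ (MvPolynomial σ ℝ))
    [Module.Finite ℝ (MvPolynomial σ ℝ ⧸ A)] :
    ∃ T ⊆ Set.range fun α => monomial α (1 : ℝ), T.Finite ∧
      T.ncard ≤ Module.finrank ℝ (MvPolynomial σ ℝ ⧸ A) ∧ Submodule.span ℝ T ⊔ A = ⊤ := by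
  obtain ⟨b, -, -, hb2, hb3⟩ := exists_linearIndepOn_extension (K := ℝ)
    (v := fun α : σ →₀ ℕ => A.mkQ (monomial α (1 : ℝ)))
    (linearIndepOn_empty ℝ _) (Set.empty_subset Set.univ)
  have hli : LinearIndependent ℝ (fun α : b => A.mkQ (monomial (α : σ →₀ ℕ) (1 : ℝ))) := hb3
  have hbf : b.Finite := hli.finite
  have : Fintype b := hbf.fintype
  refine ⟨(fun α => monomial α (1 : ℝ)) '' b, Set.image_subset_range _ _, hbf.image _, ?_, ?_⟩
  · refine (Set.ncard_image_le hbf).trans ?_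
    rw [← Nat.card_coe_set_eq, Nat.card_eq_fintype_card]
    exact hli.fintype_card_le_finrank
  · rw [eq_top_iff]
    intro q _
    induction q using MvPolynomial.induction_on' with
    | add p q hp hq => exact add_mem (hp trivial) (hq trivial)
    | monomial α a =>
      have h1 : A.mkQ (monomial α (1 : ℝ)) ∈
          (Submodule.span ℝ ((fun α => monomial α (1 : ℝ)) '' b)).map A.mkQ := by
        rw [Submodule.map_span, Set.image_image]
        exact hb2 ⟨α, trivial, rfl⟩
      have h2 : monomial α (1 : ℝ) ∈ Submodule.span ℝ ((fun α => monomial α (1 : ℝ)) '' b) ⊔ A := by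
        have h3 : monomial α (1 : ℝ) ∈ Submodule.comap A.mkQ
          ((Submodule.span ℝ ((fun α => monomial α (1 : ℝ)) '' b)).map A.mkQ) := h1
        rwa [Submodule.comap_map_mkQ, sup_comm] at h3
      have h3 : monomial α a = a • monomial α (1 : ℝ) := by rw [smul_monomial, smul_eq_mul, mul_one]
      rw [h3]
      exact Submodule.smul_mem _ _ h2

lemma card_basesMod_le_finrank (X : Fin N → Fin r → ℝ) :
    (basesMod X Finset.univ ⊥).card ≤
      Module.finrank ℝ (MvPolynomial (Fin r) ℝ ⧸ relationSpace X Finset.univ ⊥) := by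
  have := (finrank_quotient_relationSpace_le X Finset.univ ⊥).1
  obtain ⟨c, θ, hθ, hinj⟩ := exists_generic_vertices X
  obtain ⟨T, hT, hTf, hTc, htop⟩ := exists_span_monomials_isCompl (relationSpace X Finset.univ ⊥)
  let ι := {Y : Finset (Fin N) //
    Submodule.span ℝ (X '' ((Finset.univ \ Y : Finset (Fin N)) : Set (Fin N))) ≠ ⊤}
  let p' : ι → MvPolynomial (Fin r) ℝ := fun Y => ∏ i ∈ Y.1, (linPoly (X i) - C (c i))
  have hrel : relationSpace X Finset.univ ⊥ =
      (Ideal.span (Set.range fun Y : ι => prodPoly X Y.1)).restrictScalars ℝ := by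
    rw [relationSpace, linIdeal_bot, sup_bot_eq, nonspanIdeal]
    congr 2
    ext q
    constructor
    · rintro ⟨Y, -, hY, rfl⟩
      exact ⟨⟨Y, by simpa using hY⟩, rfl⟩
    · rintro ⟨Y, rfl⟩
      exact ⟨Y, Finset.subset_univ _, by simpa using Y.2, rfl⟩
  have htop' : Submodule.span ℝ T ⊔ (Ideal.span (Set.range p')).restrictScalars ℝ = ⊤ :=
    span_monomials_sup_eq_top (fun Y : ι => prodPoly_isHomogeneous X Y.1)
      (fun Y => prodPoly_sub_prod_mem_degreeLT X c Y.1) hT rfl (hrel ▸ htop)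
  have hvan : ∀ B, ∀ q ∈ Ideal.span (Set.range p'), eval (θ B) q = 0 := by
    intro B q hq
    suffices Ideal.span (Set.range p') ≤ RingHom.ker (eval (θ B)) from this hq
    refine Ideal.span_le.2 ?_
    rintro _ ⟨Y, rfl⟩
    have : ∃ i ∈ Y.1, i ∈ B.1 := by
      by_contra! h
      have hB := (mem_basesMod.1 B.2).2.1
      rw [sup_bot_eq] at hB
      refine Y.2 (eq_top_iff.2 (hB.ge.trans ?_))
      refine Submodule.span_mono (Set.image_mono fun i hi => ?_)
      simpa using fun hY => h i hY hi
    obtain ⟨i, hi, hiB⟩ := this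
    simp only [SetLike.mem_coe, RingHom.mem_ker, p', map_prod]
    refine Finset.prod_eq_zero hi ?_
    rw [map_sub, eval_linPoly, eval_C, hθ B i hiB, sub_self]
  have hli : LinearIndependent ℝ (fun B => ((eval (θ B) : MvPolynomial (Fin r) ℝ →+* ℝ) :
      MvPolynomial (Fin r) ℝ → ℝ)) := by
    have h1 : Function.Injective fun B => ((eval (θ B) : MvPolynomial (Fin r) ℝ →+* ℝ) :
        MvPolynomial (Fin r) ℝ →* ℝ) := by
      intro B B' h
      refine hinj (funext fun j => ?_)
      simpa using DFunLike.congr_fun h (MvPolynomial.X j)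
    exact (linearIndependent_monoidHom (MvPolynomial (Fin r) ℝ) ℝ).comp _ h1
  have : Module.Finite ℝ (Submodule.span ℝ T) := Module.Finite.span_of_finite ℝ hTf
  have hli' : LinearIndependent ℝ (fun B => ((aeval (θ B)).toLinearMap :
      MvPolynomial (Fin r) ℝ →ₗ[ℝ] ℝ).domRestrict (Submodule.span ℝ T)) := by
    rw [Fintype.linearIndependent_iff] at hli ⊢
    intro g hg
    refine hli g (funext fun q => ?_)
    obtain ⟨w, hw, j, hj, rfl⟩ := Submodule.mem_sup.1 (htop' ▸ Submodule.mem_top : q ∈ _)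
    have h1 := LinearMap.congr_fun hg ⟨w, hw⟩
    simp only [LinearMap.sum_apply, LinearMap.smul_apply, LinearMap.domRestrict_apply,
      AlgHom.toLinearMap_apply, LinearMap.zero_apply] at h1
    simp only [Finset.sum_apply, Pi.smul_apply, map_add, hvan _ j hj, add_zero, Pi.zero_apply]
    exact h1
  have h1 := hli'.fintype_card_le_finrank
  rw [Fintype.card_coe] at h1
  refine h1.trans (le_trans ?_ hTc)
  rw [Module.finrank_linearMap_self]
  have hTf' := hTf.fintype
  rw [Set.ncard_eq_toFinset_card']
  exact finrank_span_le_card T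

end GenericVertices

section Cocircuits

variable {r N : ℕ} {M : Type*} [AddCommGroup M] [Module ℝ M]

lemma forall_basesOn_inter_nonempty_iff (v : Fin N → M) {G C : Finset (Fin N)} :
    (∀ B ∈ basesOn v G, (C ∩ B).Nonempty) ↔
      Submodule.span ℝ (v '' ((G \ C : Finset (Fin N)) : Set (Fin N))) ≠ ⊤ := by
  constructor
  · intro h htop
    obtain ⟨b, hb, -, hspan, hli⟩ := exists_linearIndepOn_extension (K := ℝ) (v := v)
      (linearIndepOn_empty ℝ v) (Set.empty_subset ((G \ C : Finset (Fin N)) : Set (Fin N)))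
    obtain ⟨B, rfl⟩ := (b.toFinite).exists_finset_coe
    have hB : B ⊆ G \ C := Finset.coe_subset.1 hb
    obtain ⟨i, hi⟩ := h B ⟨hB.trans Finset.sdiff_subset, hli,
      eq_top_iff.2 (htop.ge.trans (Submodule.span_le.2 hspan))⟩
    rw [Finset.mem_inter] at hi
    exact (Finset.mem_sdiff.1 (hB hi.2)).2 hi.1
  · intro h B hB
    by_contra hCB
    rw [Finset.not_nonempty_iff_eq_empty, ← Finset.disjoint_iff_inter_eq_empty] at hCB
    refine h (eq_top_iff.2 (hB.2.2.ge.trans (Submodule.span_mono (Set.image_mono ?_))))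
    intro i hi
    rw [Finset.mem_coe, Finset.mem_sdiff]
    exact ⟨hB.1 hi, fun hC => Finset.disjoint_left.1 hCB hC hi⟩

lemma Jideal_basesOn_eq_span (X : Fin N → Fin r → ℝ) (v : Fin N → M) (G : Finset (Fin N)) :
    Jideal X G (basesOn v G) = Ideal.span {p | ∃ C ⊆ G,
      Submodule.span ℝ (v '' ((G \ C : Finset (Fin N)) : Set (Fin N))) ≠ ⊤ ∧
        p = prodPoly X C} := by
  apply le_antisymm
  · refine Ideal.span_mono ?_
    rintro _ ⟨C, hC, rfl⟩
    exact ⟨C, hC.1, (forall_basesOn_inter_nonempty_iff v).1 hC.2.1, rfl⟩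
  · refine Ideal.span_le.2 ?_
    rintro _ ⟨C, hC, hs, rfl⟩
    obtain ⟨D, hDC, hD⟩ := exists_minimal_le_of_wellFoundedLT
      (fun D : Finset (Fin N) => ∀ B ∈ basesOn v G, (D ∩ B).Nonempty) C
      ((forall_basesOn_inter_nonempty_iff v).2 hs)
    refine Ideal.mem_of_dvd _ (Finset.prod_dvd_prod_of_subset D C _ hDC)
      (Ideal.subset_span ⟨D, ⟨hDC.trans hC, hD.prop, fun C' hC' h => ?_⟩, rfl⟩)
    exact le_antisymm hC' (hD.le_of_le h hC')

lemma Jideal_basesOn (X : Fin N → Fin r → ℝ) (G : Finset (Fin N)) :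
    Jideal X G (basesOn X G) = nonspanIdeal X G ⊥ := by
  rw [Jideal_basesOn_eq_span, nonspanIdeal]
  simp only [sup_bot_eq]

lemma Jideal_basesOn_mkQ (X : Fin N → Fin r → ℝ) (G : Finset (Fin N))
    (L : Submodule ℝ (Fin r → ℝ)) :
    Jideal X G (basesOn (L.mkQ ∘ X) G) = nonspanIdeal X G L := by
  rw [Jideal_basesOn_eq_span, nonspanIdeal]
  congr! 6 with p C
  rw [Set.image_comp, ← Submodule.map_span, sup_comm]
  exact and_congr_left' (not_congr (Submodule.map_mkQ_eq_top L _))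

end Cocircuits

section Pairing

open MvPolynomial

variable {r : ℕ}

lemma pairing_eq_sum_of_subset {q : MvPolynomial (Fin r) ℝ} {s : Finset (Fin r →₀ ℕ)}
    (h : q.support ⊆ s) (f : MvPolynomial (Fin r) ℝ) :
    pairing q f = ∑ α ∈ s, (∏ i, ((α i).factorial : ℝ)) * q.coeff α * f.coeff α :=
  Finset.sum_subset h fun α _ hα => by rw [notMem_support_iff.1 hα]; ring

/-- The pairing with a fixed polynomial `f` as a linear functional. -/
noncomputable def pairingLeft (f : MvPolynomial (Fin r) ℝ) : MvPolynomial (Fin r) ℝ →ₗ[ℝ] ℝ where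
  toFun q := pairing q f
  map_add' p q := by
    classical
    rw [pairing_eq_sum_of_subset (support_add (p := p) (q := q)),
      pairing_eq_sum_of_subset (Finset.subset_union_left (s₁ := p.support) (s₂ := q.support)),
      pairing_eq_sum_of_subset (Finset.subset_union_right (s₁ := p.support) (s₂ := q.support)),
      ← Finset.sum_add_distrib]
    exact Finset.sum_congr rfl fun α _ => by rw [coeff_add]; ring
  map_smul' c q := by
    rw [pairing_eq_sum_of_subset (support_smul (a := c) (f := q)), pairing, RingHom.id_apply,
      smul_eq_mul, Finset.mul_sum]
    exact Finset.sum_congr rfl fun α _ => by rw [coeff_smul, smul_eq_mul]; ring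

lemma pairingLeft_monomial (f : MvPolynomial (Fin r) ℝ) (α : Fin r →₀ ℕ) (c : ℝ) :
    pairingLeft f (monomial α c) = (∏ i, ((α i).factorial : ℝ)) * c * f.coeff α := by
  change pairing _ f = _
  rw [pairing_eq_sum_of_subset support_monomial_subset]
  simp

lemma pairingLeft_injective :
    Function.Injective (pairingLeft (r := r)) := by
  intro f g h
  ext α
  have h1 := LinearMap.congr_fun h (monomial α 1)
  rw [pairingLeft_monomial, pairingLeft_monomial] at h1
  refine mul_left_cancel₀ ?_ h1
  rw [mul_one]
  exact Finset.prod_ne_zero_iff.2 fun i _ => Nat.cast_ne_zero.2 (Nat.factorial_ne_zero _)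

lemma pairingLeft_X_mul (i : Fin r) (q f : MvPolynomial (Fin r) ℝ) :
    pairingLeft f (X i * q) = pairingLeft (pderiv i f) q := by
  induction q using MvPolynomial.induction_on' with
  | add p q hp hq => rw [mul_add, map_add, map_add, hp, hq]
  | monomial α c =>
    rw [X, monomial_mul, one_mul, pairingLeft_monomial, pairingLeft_monomial, coeff_pderiv,
      add_comm (Finsupp.single i 1) α]
    have h : ∏ j, (((α + Finsupp.single i 1 : Fin r →₀ ℕ) j).factorial : ℝ) =
        (∏ j, ((α j).factorial : ℝ)) * (α i + 1) := by
      rw [← Finset.mul_prod_erase _ _ (Finset.mem_univ i),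
        ← Finset.mul_prod_erase _ (fun j => ((α j).factorial : ℝ)) (Finset.mem_univ i)]
      have h1 : ∏ j ∈ Finset.univ.erase i, (((α + Finsupp.single i 1 : Fin r →₀ ℕ) j).factorial : ℝ) =
          ∏ j ∈ Finset.univ.erase i, ((α j).factorial : ℝ) := by
        refine Finset.prod_congr rfl fun j hj => ?_
        rw [Finsupp.add_apply, Finsupp.single_eq_of_ne (Finset.ne_of_mem_erase hj), add_zero]
      rw [h1, Finsupp.add_apply, Finsupp.single_eq_same, Nat.factorial_succ]
      push_cast
      ring
    rw [h]
    ring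

lemma pairingLeft_linPoly_mul (u : Fin r → ℝ) (q f : MvPolynomial (Fin r) ℝ) :
    pairingLeft f (linPoly u * q) = pairingLeft (dirDeriv u f) q := by
  have h : ∀ i, pairingLeft f (C (u i) * X i * q) = pairing q (u i • pderiv i f) := fun i => by
    rw [mul_assoc, ← smul_eq_C_mul, map_smul, pairingLeft_X_mul, pairing_smul]; rfl
  rw [linPoly, Finset.sum_mul, map_sum, Finset.sum_congr rfl fun i _ => h i]
  change _ = pairing q (dirDeriv u f)
  have hs : ∀ s : Finset (Fin r), ∑ i ∈ s, pairing q (u i • pderiv i f) =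
      pairing q (∑ i ∈ s, u i • pderiv i f) := fun s => by
    induction s using Finset.induction_on with
    | empty => simp [pairing_zero]
    | insert a s ha ih => rw [Finset.sum_insert ha, Finset.sum_insert ha, pairing_add, ih]
  rw [hs]
  simp [dirDeriv]

lemma mem_kerIdeal {I : Ideal (MvPolynomial (Fin r) ℝ)} {f : MvPolynomial (Fin r) ℝ} :
    f ∈ kerIdeal I ↔ ∀ q ∈ I, pairingLeft f q = 0 := Iff.rfl

lemma kerIdeal_sup (I J : Ideal (MvPolynomial (Fin r) ℝ)) :
    kerIdeal (I ⊔ J) = kerIdeal I ⊓ kerIdeal J := by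
  ext f
  simp only [Submodule.mem_inf, mem_kerIdeal]
  refine ⟨fun h => ⟨fun q hq => h q (Submodule.mem_sup_left hq),
    fun q hq => h q (Submodule.mem_sup_right hq)⟩, fun h q hq => ?_⟩
  obtain ⟨a, ha, b, hb, rfl⟩ := Submodule.mem_sup.1 hq
  rw [map_add, h.1 a ha, h.2 b hb, add_zero]

lemma kerIdeal_span_linPoly (u : Fin r → ℝ) :
    kerIdeal (Ideal.span {linPoly u}) = LinearMap.ker (dirDeriv u) := by
  ext f
  rw [mem_kerIdeal, LinearMap.mem_ker]
  have h0 : pairingLeft (0 : MvPolynomial (Fin r) ℝ) = 0 := LinearMap.ext fun q => pairing_zero q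
  constructor
  · intro h
    refine pairingLeft_injective (LinearMap.ext fun q => ?_)
    rw [← pairingLeft_linPoly_mul, h0, LinearMap.zero_apply]
    exact h _ (Ideal.mem_span_singleton.2 (dvd_mul_right _ _))
  · intro h q hq
    obtain ⟨q, rfl⟩ := Ideal.mem_span_singleton.1 hq
    rw [pairingLeft_linPoly_mul, h, h0, LinearMap.zero_apply]

/-- Functionals vanishing on all monomials of large degree are represented by polynomials. -/
lemma exists_pairingLeft_eq {n : ℕ} (ψ : MvPolynomial (Fin r) ℝ →ₗ[ℝ] ℝ)
    (h : ∀ q ∈ idealOfVars (Fin r) ℝ ^ n, ψ q = 0) : ∃ f, pairingLeft f = ψ := by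
  classical
  have hfin : {α : Fin r →₀ ℕ | α.degree ≤ n}.Finite := Finsupp.finite_of_degree_le n
  refine ⟨∑ α ∈ hfin.toFinset,
    monomial α ((∏ i, ((α i).factorial : ℝ))⁻¹ * ψ (monomial α 1)), ?_⟩
  refine MvPolynomial.linearMap_ext fun α => LinearMap.ext_ring ?_
  rw [LinearMap.comp_apply, LinearMap.comp_apply, pairingLeft_monomial, coeff_sum]
  simp only [coeff_monomial, Finset.sum_ite_eq', Set.Finite.mem_toFinset, Set.mem_ofPred_eq]
  split_ifs with hα
  · rw [mul_one, mul_inv_cancel_left₀]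
    exact Finset.prod_ne_zero_iff.2 fun i _ => Nat.cast_ne_zero.2 (Nat.factorial_ne_zero _)
  · rw [mul_zero]
    exact (h _ ((monomial_mem_pow_idealOfVars_iff n α one_ne_zero).2 (by omega))).symm

end Pairing

section Exactness

open MvPolynomial

variable {r N : ℕ} {X : Fin N → Fin r → ℝ} {G : Finset (Fin N)} {x : Fin N}

lemma nonspanIdeal_sup_span_linPoly (L : Submodule ℝ (Fin r → ℝ)) (hx : x ∉ G) :
    nonspanIdeal X (insert x G) L ⊔ Ideal.span {linPoly (X x)} =
      nonspanIdeal X G (L ⊔ Submodule.span ℝ {X x}) ⊔ Ideal.span {linPoly (X x)} :=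
  le_antisymm (sup_le nonspanIdeal_insert_le le_sup_right)
    (sup_le_sup_right (nonspanIdeal_sup_span_singleton_le hx) _)

/-- Multiplication by `p_x` is injective from the quotient for `X ∖ x` to that for `X`. -/
lemma mem_nonspanIdeal_of_linPoly_mul_mem (hG : insert x G = Finset.univ) (hx : x ∉ G)
    (h0 : X x ≠ 0) {q : MvPolynomial (Fin r) ℝ}
    (hq : linPoly (X x) * q ∈ nonspanIdeal X Finset.univ ⊥) : q ∈ nonspanIdeal X G ⊥ := by
  obtain ⟨h1, h2, -⟩ := finrank_quotient_relationSpace_le X G ⊥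
  obtain ⟨h3, h4, -⟩ := finrank_quotient_relationSpace_le X G (⊥ ⊔ Submodule.span ℝ {X x})
  have h5 := card_basesMod_add_le (X := X) (L := ⊥) hx (by simpa using h0)
  have h6 := (finrank_quotient_le_of_comap (relationSpace_le_comap (X := X) (L := ⊥) hx)
    (relationSpace_sup_span_singleton_le (X := X) (L := ⊥) hx)).2.2
  rw [hG] at h5 h6
  have h7 := h6 (by have := card_basesMod_le_finrank X; omega)
  simpa [relationSpace, linIdeal_bot] using
    h7 (show linPoly (X x) * q ∈ relationSpace X Finset.univ ⊥ from Submodule.mem_sup_left hq)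

lemma exists_dirDeriv_eq (hG : insert x G = Finset.univ) (hx : x ∉ G) (h0 : X x ≠ 0)
    {g : MvPolynomial (Fin r) ℝ} (hg : g ∈ kerIdeal (nonspanIdeal X G ⊥)) :
    ∃ f ∈ kerIdeal (nonspanIdeal X Finset.univ ⊥), dirDeriv (X x) f = g := by
  obtain ⟨-, -, n, hn⟩ := finrank_quotient_relationSpace_le X Finset.univ ⊥
  rw [linIdeal_bot, sup_bot_eq] at hn
  set A := (nonspanIdeal X G ⊥).restrictScalars ℝ
  set I := (nonspanIdeal X Finset.univ ⊥).restrictScalars ℝ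
  have hAI : A ≤ I.comap (LinearMap.mulLeft ℝ (linPoly (X x))) := fun q hq => by
    have := linPoly_mul_mem_nonspanIdeal hx hq
    rwa [hG] at this
  have hker : LinearMap.ker (A.mapQ I _ hAI) = ⊥ := by
    rw [LinearMap.ker_eq_bot']
    intro q hq
    obtain ⟨q, rfl⟩ := Submodule.mkQ_surjective _ q
    rw [Submodule.mkQ_apply, Submodule.mapQ_apply, Submodule.Quotient.mk_eq_zero] at hq
    exact (Submodule.Quotient.mk_eq_zero A).2 (mem_nonspanIdeal_of_linPoly_mul_mem hG hx h0 hq)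
  obtain ⟨s, hs⟩ := LinearMap.exists_leftInverse_of_injective _ hker
  set γ : (MvPolynomial (Fin r) ℝ ⧸ A) →ₗ[ℝ] ℝ := A.liftQ (pairingLeft g) hg
  have hψ : ∀ q ∈ nonspanIdeal X Finset.univ ⊥, (γ ∘ₗ s ∘ₗ I.mkQ) q = 0 := by
    intro q hq
    have : I.mkQ q = 0 := (Submodule.Quotient.mk_eq_zero I).2 hq
    rw [LinearMap.comp_apply, LinearMap.comp_apply, this, map_zero, map_zero]
  obtain ⟨f, hf⟩ := exists_pairingLeft_eq (γ ∘ₗ s ∘ₗ I.mkQ) fun q hq => hψ q (hn hq)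
  refine ⟨f, mem_kerIdeal.2 fun q hq => hf ▸ hψ q hq, ?_⟩
  refine pairingLeft_injective (LinearMap.ext fun q => ?_)
  rw [← pairingLeft_linPoly_mul, hf]
  have h1 := LinearMap.congr_fun hs (A.mkQ q)
  rw [LinearMap.comp_apply, Submodule.mkQ_apply, Submodule.mapQ_apply] at h1
  rw [LinearMap.comp_apply, LinearMap.comp_apply, Submodule.mkQ_apply]
  rw [LinearMap.mulLeft_apply] at h1
  rw [h1]
  rfl

end Exactness

/-- for `x ∈ X` neither a loop nor a coloop, the sequence
`0 → 𝒟(X/x) →(j_x) 𝒟(X) →(D_x) 𝒟(X∖x) → 0` is exact. -/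
theorem statement8 {r N : ℕ} (X : Fin N → Fin r → ℝ)
    (hX : Submodule.span ℝ (Set.range X) = ⊤) (i0 : Fin N)
    (hloop : X i0 ≠ 0)
    (hcoloop : Submodule.span ℝ
      (X '' ((Finset.univ.erase i0 : Finset (Fin N)) : Set (Fin N))) = ⊤) :
    (DspaceContr X i0 ≤ Dspace X Finset.univ (basesOn X Finset.univ)) ∧
    (∀ f ∈ Dspace X Finset.univ (basesOn X Finset.univ),
      dirDeriv (X i0) f ∈
        Dspace X (Finset.univ.erase i0) (basesOn X (Finset.univ.erase i0))) ∧
    (∀ g ∈ Dspace X (Finset.univ.erase i0) (basesOn X (Finset.univ.erase i0)),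
      ∃ f ∈ Dspace X Finset.univ (basesOn X Finset.univ), dirDeriv (X i0) f = g) ∧
    (Dspace X Finset.univ (basesOn X Finset.univ) ⊓ LinearMap.ker (dirDeriv (X i0))
      = DspaceContr X i0) := by
  have hx : i0 ∉ (Finset.univ.erase i0 : Finset (Fin N)) := Finset.notMem_erase _ _
  have hG : insert i0 (Finset.univ.erase i0) = (Finset.univ : Finset (Fin N)) :=
    Finset.insert_erase (Finset.mem_univ i0)
  have hker : Dspace X Finset.univ (basesOn X Finset.univ) ⊓ LinearMap.ker (dirDeriv (X i0))
      = DspaceContr X i0 := by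
    have h := nonspanIdeal_sup_span_linPoly (X := X) ⊥ hx
    rw [hG, bot_sup_eq] at h
    rw [DspaceContr, Dspace, Dspace, Jideal_basesOn, Jideal_basesOn_mkQ, ← kerIdeal_span_linPoly,
      ← kerIdeal_sup, ← kerIdeal_sup, h]
  refine ⟨hker ▸ inf_le_left, ?_, ?_, hker⟩
  · intro f hf
    rw [Dspace, Jideal_basesOn, mem_kerIdeal] at *
    intro q hq
    rw [← pairingLeft_linPoly_mul]
    have := linPoly_mul_mem_nonspanIdeal hx hq
    rw [hG] at this
    exact hf _ this
  · intro g hg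
    rw [Dspace, Jideal_basesOn] at *
    exact exists_dirDeriv_eq hG hx hloop hg
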